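/- arXiv:1612.09406 — 5 statements merged into one kernel-verified Lean document; each statement's English description precedes it below -/
import Mathlib

section
/- Let h₁ = (y−z)²z − x³ − x²z and h₂ = x³ − 2xy² + 2xyz + y²z in ℂ[x,y,z]. Every homogeneous polynomial f of degree 5 in ℂ[x,y,z] satisfying all of the following conditions is the zero polynomial: (i) f(a,b,c) = 0 for every nonzero (a,b,c) ∈ ℂ³ with h₁(a,b,c) = h₂(a,b,c) = 0; (ii) every iterated partial derivative of f of total order < 3 vanishes at (4,9,6); (iii) every iterated partial derivative of f of total order < 2 vanishes at (0,1,1); (iv) every iterated partial derivative of f of total order < 2 vanishes at (0,0,1). -/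
open MvPolynomial

/-- `f` vanishes to order at least `m` at the point `p ∈ ℂ³`: every iterated partial
derivative of `f` of total order `< m` vanishes at `p`. -/
def VanishesToOrder (f : MvPolynomial (Fin 3) ℂ) (p : Fin 3 → ℂ) (m : ℕ) : Prop :=
  ∀ L : List (Fin 3), L.length < m →
    MvPolynomial.eval p (L.foldr (fun i g => MvPolynomial.pderiv i g) f) = 0

/-- The nodal cubic `h₁ = (y-z)²z - x³ - x²z`. -/
noncomputable def h₁ : MvPolynomial (Fin 3) ℂ :=
  (X 1 - X 2) ^ 2 * X 2 - X 0 ^ 3 - X 0 ^ 2 * X 2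

/-- The nodal cubic `h₂ = x³ - 2xy² + 2xyz + y²z`. -/
noncomputable def h₂ : MvPolynomial (Fin 3) ℂ :=
  X 0 ^ 3 - 2 * X 0 * X 1 ^ 2 + 2 * X 0 * X 1 * X 2 + X 1 ^ 2 * X 2

/-- A ternary form of degree `n`, written out in monomials. -/
theorem MvPolynomial.IsHomogeneous.exists_ternary_form {R : Type*} [CommSemiring R]
    {f : MvPolynomial (Fin 3) R} {n : ℕ} (hf : f.IsHomogeneous n) :
    ∃ c : ℕ → ℕ → R, f = ∑ i ∈ Finset.range (n + 1), ∑ j ∈ Finset.range (n + 1 - i),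
      C (c i j) * (X 0 ^ i * X 1 ^ j * X 2 ^ (n - i - j)) := by
  refine ⟨fun i j => coeff
    (Finsupp.single 0 i + Finsupp.single 1 j + Finsupp.single 2 (n - i - j)) f, ?_⟩
  have hdeg : ∀ d ∈ f.support, d 0 + d 1 + d 2 = n := by
    intro d hd
    have h := hf (mem_support_iff.mp hd)
    rw [Finsupp.weight_apply, Finsupp.sum_fintype _ _ (by simp)] at h
    simpa [Fin.sum_univ_three] using h
  have hd_eq : ∀ d ∈ f.support, Finsupp.single 0 (d 0) + Finsupp.single 1 (d 1) +
      Finsupp.single 2 (n - d 0 - d 1) = d := by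
    intro d hd
    have h := hdeg d hd
    ext k
    fin_cases k <;> simp
    omega
  have hmon : ∀ i j k : ℕ, ∀ a : R, C a * (X 0 ^ i * X 1 ^ j * X 2 ^ k) =
      monomial (Finsupp.single (0 : Fin 3) i + Finsupp.single 1 j + Finsupp.single 2 k) a := by
    intro i j k a
    simp [X_pow_eq_monomial, monomial_mul, C_mul_monomial]
  simp only [hmon]
  rw [Finset.sum_sigma']
  conv_lhs => rw [f.as_sum]
  refine Finset.sum_of_injOn (fun d => ⟨d 0, d 1⟩) ?_ ?_ ?_ ?_
  · intro d hd d' hd' h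
    simp only [Sigma.mk.injEq, heq_eq_eq] at h
    rw [← hd_eq d hd, ← hd_eq d' hd', h.1, h.2]
  · intro d hd
    have := hdeg d hd
    simp only [Finset.coe_sigma, Set.mem_sigma_iff, Finset.coe_range, Set.mem_Iio]
    omega
  · rintro ⟨i, j⟩ _ hij
    rw [monomial_eq_zero]
    by_contra h
    refine hij ⟨_, mem_support_iff.mpr h, ?_⟩
    simp
  · intro d hd
    simp only [hd_eq d hd]

/-- A polynomial of degree at most four vanishing at the five distinct complex roots of
`2t⁵ - 4t³ + 2t² + 3t - 2` is zero. -/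
theorem eq_zero_of_vanish_on_quintic_roots {r₀ r₁ r₂ r₃ r₄ : ℂ}
    (h : ∀ t : ℂ, 2 * t ^ 5 - 4 * t ^ 3 + 2 * t ^ 2 + 3 * t - 2 = 0 →
      r₀ + r₁ * t + r₂ * t ^ 2 + r₃ * t ^ 3 + r₄ * t ^ 4 = 0) :
    r₀ = 0 ∧ r₁ = 0 ∧ r₂ = 0 ∧ r₃ = 0 ∧ r₄ = 0 := by
  set q : Polynomial ℂ :=
    2 * Polynomial.X ^ 5 - 4 * Polynomial.X ^ 3 + 2 * Polynomial.X ^ 2 + 3 * Polynomial.X - 2 with hq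
  set r : Polynomial ℂ :=
    Polynomial.C r₀ + Polynomial.C r₁ * Polynomial.X + Polynomial.C r₂ * Polynomial.X ^ 2 +
      Polynomial.C r₃ * Polynomial.X ^ 3 + Polynomial.C r₄ * Polynomial.X ^ 4 with hr
  have hqdeg : q.natDegree = 5 := by rw [hq]; compute_degree!
  have hrdeg : r.natDegree ≤ 4 := by rw [hr]; compute_degree
  have hsep : q.Separable := by
    have hinv : Polynomial.C (1 / 469 : ℂ) * 469 = 1 := by
      rw [← Polynomial.C_ofNat, ← Polynomial.C_mul, ← Polynomial.C_1]
      norm_num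
    have hder : Polynomial.derivative q =
        10 * Polynomial.X ^ 4 - 12 * Polynomial.X ^ 2 + 4 * Polynomial.X + 3 := by
      simp [hq, map_ofNat Polynomial.C]
      ring
    refine ⟨Polynomial.C (1 / 469) * (229 + 810 * Polynomial.X - 1095 * Polynomial.X ^ 2 -
        1000 * Polynomial.X ^ 3),
      Polynomial.C (1 / 469) * (309 - 101 * Polynomial.X - 322 * Polynomial.X ^ 2 +
        219 * Polynomial.X ^ 3 + 200 * Polynomial.X ^ 4), ?_⟩
    rw [hder, hq]
    linear_combination hinv
  have hr0 : r = 0 := by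
    refine Polynomial.eq_zero_of_natDegree_lt_card_of_eval_eq_zero' r q.roots.toFinset ?_ ?_
    · intro t ht
      have ht' := (Polynomial.mem_roots'.mp (Multiset.mem_toFinset.mp ht)).2
      have := h t (by simpa [hq, Polynomial.IsRoot] using ht')
      simpa [hr] using this
    · rw [Multiset.toFinset_card_of_nodup (Polynomial.nodup_roots hsep),
        ← (IsAlgClosed.splits q).natDegree_eq_card_roots, hqdeg]
      omega
  have hc : ∀ k, r.coeff k = 0 := by simp [hr0]
  refine ⟨?_, ?_, ?_, ?_, ?_⟩
  · simpa [hr, Polynomial.coeff_X, Polynomial.coeff_C] using hc 0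
  · simpa [hr, Polynomial.coeff_X, Polynomial.coeff_C] using hc 1
  · simpa [hr, Polynomial.coeff_X, Polynomial.coeff_C] using hc 2
  · simpa [hr, Polynomial.coeff_X, Polynomial.coeff_C] using hc 3
  · simpa [hr, Polynomial.coeff_X, Polynomial.coeff_C] using hc 4

set_option maxHeartbeats 4000000 in
/-- Every homogeneous quintic vanishing at all nine base points of the pencil `⟨h₁, h₂⟩`, to
order `≥ 3` at `(4,9,6)` and to order `≥ 2` at the nodes `(0,1,1)` and `(0,0,1)`, is zero
(the computation `h⁰₁₁,₀ = h⁰₁₂,₁₁ = 0`). -/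
theorem degree_five_vanishing_h0_11_0
    (f : MvPolynomial (Fin 3) ℂ)
    (hf : f.IsHomogeneous 5)
    (hbase : ∀ p : Fin 3 → ℂ, p ≠ 0 → MvPolynomial.eval p h₁ = 0 →
      MvPolynomial.eval p h₂ = 0 → MvPolynomial.eval p f = 0)
    (hE0 : VanishesToOrder f ![4, 9, 6] 3)
    (hB1 : VanishesToOrder f ![0, 1, 1] 2)
    (hB2 : VanishesToOrder f ![0, 0, 1] 2) :
    f = 0 := by
  obtain ⟨c, hfc⟩ := hf.exists_ternary_form
  have c00 := hB2 [] (by simp)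
  have c10 := hB2 [0] (by simp)
  have c01 := hB2 [1] (by simp)
  have c05 := hbase ![0, 1, 0] (by simp) (by simp [h₁]) (by simp [h₂])
  have m0 := hB1 [0] (by simp)
  have m1 := hB1 [1] (by simp)
  have m2 := hB1 [2] (by simp)
  have e00 := hE0 [0, 0] (by simp)
  have e01 := hE0 [0, 1] (by simp)
  have e02 := hE0 [0, 2] (by simp)
  have e11 := hE0 [1, 1] (by simp)
  have e12 := hE0 [1, 2] (by simp)
  have e22 := hE0 [2, 2] (by simp)
  have p : eval ![-1, 1, 1] f = 0 :=
    hbase _ (by simp) (by simp [h₁]; norm_num) (by simp [h₂]; norm_num)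
  have hs : ∀ s : ℂ, s ^ 2 = 2 → eval ![1, 1 + s, 1] f = 0 := fun s hs =>
    hbase _ (by simp) (by simp [h₁, hs]; norm_num) (by simp [h₂]; linear_combination -hs)
  have ht : ∀ t : ℂ, 2 * t ^ 5 - 4 * t ^ 3 + 2 * t ^ 2 + 3 * t - 2 = 0 →
      eval ![t ^ 2 - 1, t ^ 3 - t + 1, 1] f = 0 := fun t ht =>
    hbase _ (by simp) (by simp [h₁]; ring)
      (by simp [h₂]; linear_combination (2 - t ^ 2) * t * ht)
  have hnum : ∀ (i : Fin 3) (n : ℕ) [n.AtLeastTwo],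
      pderiv i (OfNat.ofNat n : MvPolynomial (Fin 3) ℂ) = 0 := fun i n _ =>
    Derivation.map_natCast _ _
  simp [hfc, Finset.sum_range_succ, pderiv_X, Derivation.leibniz, Derivation.leibniz_pow,
    hnum] at c00 c10 c01 c05 m0 m1 m2 e00 e01 e02 e11 e12 e22 p hs ht
  simp only [c00, c10, c01, c05] at m0 m1 m2 e00 e01 e02 e11 e12 e22 p hs ht
  obtain ⟨r0, r1, r2, r3, r4⟩ := eq_zero_of_vanish_on_quintic_roots fun t hq => show
      (c 0 2 + 1 / 2 * c 0 3 + c 2 0 + 1 / 4 * c 2 3 - c 3 0 - 1 / 2 * c 3 1 + 1 / 2 * c 4 1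
          + c 5 0) +
        (-c 0 2 - 1 / 4 * c 0 3 + 1 / 2 * c 0 4 - 1 / 2 * c 1 1 - 1 / 2 * c 1 2 - 1 / 2 * c 1 3
          - 1 / 4 * c 1 4 + 1 / 2 * c 2 1 - 3 / 8 * c 2 3 + c 3 0 + 1 / 4 * c 3 1 - 1 / 2 * c 4 0
          - 1 / 4 * c 4 1 - 1 / 2 * c 5 0) * t +
        (-1 / 2 * c 0 2 - 1 / 2 * c 0 3 - 1 / 2 * c 0 4 + 1 / 2 * c 1 2 + 1 / 2 * c 1 3
          + 1 / 8 * c 1 4 - 2 * c 2 0 + 1 / 4 * c 2 2 + 3 / 2 * c 3 0 + 1 / 2 * c 3 1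
          - 1 / 4 * c 3 2 - c 4 1 - 7 / 4 * c 5 0) * t ^ 2 +
        (c 0 2 + 1 / 2 * c 0 3 + 1 / 4 * c 1 3 + 1 / 4 * c 1 4 - 1 / 2 * c 2 1 + 1 / 4 * c 2 3
          - c 3 0 + c 4 0 + 1 / 4 * c 4 1) * t ^ 3 +
        (1 / 4 * c 0 4 - 1 / 2 * c 1 2 - 1 / 2 * c 1 3 - 1 / 4 * c 1 4 + c 2 0 - c 3 0
          + 1 / 4 * c 3 2 + 1 / 2 * c 4 0 + 1 / 2 * c 4 1 + 1 / 2 * c 5 0) * t ^ 4 = 0 by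
    linear_combination ht t hq - ((-1 / 4 * c 0 3 - 1 / 2 * c 0 4 + 1 / 2 * c 1 1 + 1 / 2 * c 1 2
      + 1 / 2 * c 1 3 + 1 / 2 * c 1 4 - 1 / 2 * c 2 1 - 1 / 2 * c 2 2 - 3 / 8 * c 2 3
      + 1 / 4 * c 3 1 + 1 / 2 * c 3 2 - 1 / 2 * c 4 0 - 1 / 4 * c 4 1 + c 5 0) + (1 / 2 * c 0 2
      + c 0 3 + 3 / 2 * c 0 4 - 1 / 2 * c 1 2 - c 1 3 - 11 / 8 * c 1 4 + 1 / 4 * c 2 2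
      + 3 / 4 * c 2 3 + 1 / 2 * c 3 0 - 1 / 4 * c 3 2 - c 4 0 + 5 / 4 * c 5 0) * t
      + (-1 / 2 * c 0 3 - 3 / 2 * c 0 4 + 1 / 4 * c 1 3 + c 1 4 + 1 / 2 * c 2 1 + 1 / 2 * c 2 2
      + 1 / 4 * c 2 3 - c 3 1 - c 3 2 + 5 / 4 * c 4 1 - 1 / 2 * c 5 0) * t ^ 2 + (1 / 4 * c 0 4
      + 1 / 2 * c 1 2 + c 1 3 + 5 / 4 * c 1 4 - c 2 2 - 2 * c 2 3 + 5 / 4 * c 3 2 + 1 / 2 * c 4 0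
      - 3 / 2 * c 5 0) * t ^ 3 + (1 / 2 * c 0 3 + 3 / 2 * c 0 4 - c 1 3 - 3 * c 1 4
      + 5 / 4 * c 2 3 + 1 / 2 * c 3 1 + 1 / 2 * c 3 2 - 3 / 2 * c 4 1) * t ^ 4 + (-c 0 4
      + 5 / 4 * c 1 4 + 1 / 2 * c 2 2 + c 2 3 - 3 / 2 * c 3 2 + 1 / 2 * c 5 0) * t ^ 5
      + (1 / 2 * c 1 3 + 3 / 2 * c 1 4 - 3 / 2 * c 2 3 + 1 / 2 * c 4 1) * t ^ 6 + (1 / 2 * c 0 4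
      - 3 / 2 * c 1 4 + 1 / 2 * c 3 2) * t ^ 7 + (1 / 2 * c 2 3) * t ^ 8
      + (1 / 2 * c 1 4) * t ^ 9) * hq
  obtain ⟨s0, s1⟩ : 3 * c 0 2 + 7 * c 0 3 + 17 * c 0 4 + c 1 1 + 3 * c 1 2 + 7 * c 1 3
    + 17 * c 1 4 + c 2 0 + c 2 1 + 3 * c 2 2 + 7 * c 2 3 + c 3 0 + c 3 1 + 3 * c 3 2 + c 4 0
    + c 4 1 + c 5 0 = 0 ∧
      2 * c 0 2 + 5 * c 0 3 + 12 * c 0 4 + c 1 1 + 2 * c 1 2 + 5 * c 1 3 + 12 * c 1 4 + c 2 1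
        + 2 * c 2 2 + 5 * c 2 3 + c 3 1 + 2 * c 3 2 + c 4 1 = 0 := by
    obtain ⟨s, hs2⟩ := IsAlgClosed.exists_pow_nat_eq (2 : ℂ) two_pos
    have hs0 : s ≠ 0 := by rintro rfl; norm_num at hs2
    have hS : ∀ s : ℂ, s ^ 2 = 2 → (3 * c 0 2 + 7 * c 0 3 + 17 * c 0 4 + c 1 1 + 3 * c 1 2
      + 7 * c 1 3 + 17 * c 1 4 + c 2 0 + c 2 1 + 3 * c 2 2 + 7 * c 2 3 + c 3 0 + c 3 1 + 3 * c 3 2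
      + c 4 0 + c 4 1 + c 5 0) + (2 * c 0 2 + 5 * c 0 3 + 12 * c 0 4 + c 1 1 + 2 * c 1 2
      + 5 * c 1 3 + 12 * c 1 4 + c 2 1 + 2 * c 2 2 + 5 * c 2 3 + c 3 1 + 2 * c 3 2
      + c 4 1) * s = 0 := fun s h => by
      linear_combination hs s h - ((c 0 2 + 3 * c 0 3 + 8 * c 0 4 + c 1 2 + 3 * c 1 3 + 8 * c 1 4
        + c 2 2 + 3 * c 2 3 + c 3 2) + (c 0 3 + 4 * c 0 4 + c 1 3 + 4 * c 1 4 + c 2 3) * s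
        + (c 0 4 + c 1 4) * s ^ 2) * h
    have h1 := hS s hs2
    have h2 := hS (-s) (by rw [neg_sq, hs2])
    refine ⟨by linear_combination (h1 + h2) / 2, mul_left_cancel₀ hs0 ?_⟩
    linear_combination (h1 - h2) / 2
  clear hs ht hbase hE0 hB1 hB2 hnum
  ring_nf at m0 m1 m2 e00 e01 e02 e11 e12 e22 p
  have c02 : c 0 2 = 0 := by grind
  have c03 : c 0 3 = 0 := by grind
  have c04 : c 0 4 = 0 := by grind
  have c11 : c 1 1 = 0 := by grind
  have c12 : c 1 2 = 0 := by grind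
  have c13 : c 1 3 = 0 := by grind
  have c14 : c 1 4 = 0 := by grind
  have c20 : c 2 0 = 0 := by grind
  have c21 : c 2 1 = 0 := by grind
  have c22 : c 2 2 = 0 := by grind
  have c23 : c 2 3 = 0 := by grind
  have c30 : c 3 0 = 0 := by grind
  have c31 : c 3 1 = 0 := by grind
  have c32 : c 3 2 = 0 := by grind
  have c40 : c 4 0 = 0 := by grind
  have c41 : c 4 1 = 0 := by grind
  have c50 : c 5 0 = 0 := by grind
  simp [Finset.sum_range_succ, *]
end

section
/- Let h₁ = (y−z)²z − x³ − x²z and h₂ = x³ − 2xy² + 2xyz + y²z in ℂ[x,y,z]. Every homogeneous polynomial f of degree 4 in ℂ[x,y,z] satisfying all of the following conditions is the zero polynomial: (i) f(a,b,c) = 0 for every nonzero (a,b,c) ∈ ℂ³ with h₁(a,b,c) = h₂(a,b,c) = 0 that is not a scalar multiple of (0,1,0); (ii) every iterated partial derivative of f of total order < 2 vanishes at (4,9,6); (iii) f(0,1,1) = 0; (iv) every iterated partial derivative of f of total order < 2 vanishes at (0,0,1). -/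
open MvPolynomial

/-- A ternary form of degree `n` is the sum of its terms, indexed by the exponents of the first
two variables. -/
theorem isHomogeneous_fin_three_eq_sum {R : Type*} [CommSemiring R] {n : ℕ}
    {f : MvPolynomial (Fin 3) R} (hf : f.IsHomogeneous n) :
    ∃ c : ℕ → ℕ → R, f = ∑ i ∈ Finset.range (n + 1), ∑ j ∈ Finset.range (n + 1 - i),
      C (c i j) * (X 0 ^ i * X 1 ^ j * X 2 ^ (n - i - j)) := by
  classical
  let e : ℕ → ℕ → Fin 3 →₀ ℕ := fun i j =>
    Finsupp.single 0 i + Finsupp.single 1 j + Finsupp.single 2 (n - i - j)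
  refine ⟨fun i j => coeff (e i j) f, ?_⟩
  have hmon (i j : ℕ) : C (coeff (e i j) f) * (X 0 ^ i * X 1 ^ j * X 2 ^ (n - i - j)) =
      monomial (e i j) (coeff (e i j) f) := by
    simp only [X_pow_eq_monomial, monomial_mul, C_mul_monomial, mul_one, e]
  simp only [hmon]
  ext d
  simp only [coeff_sum, coeff_monomial]
  have hterm (i j : ℕ) : (if e i j = d then coeff (e i j) f else 0) =
      if e i j = d then coeff d f else 0 := by
    split_ifs with h <;> simp [h]
  simp only [hterm]
  by_cases hd : coeff d f = 0
  · simp [hd]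
  have hdeg : d 0 + d 1 + d 2 = n := by
    have := hf hd
    simpa [Finsupp.weight_apply, Finsupp.sum_fintype, Fin.sum_univ_three] using this
  have he : e (d 0) (d 1) = d := by
    ext k
    fin_cases k <;> simp [e]
    omega
  have hne {i j : ℕ} (h : e i j = d) : i = d 0 ∧ j = d 1 := by
    subst h
    simp [e]
  rw [Finset.sum_eq_single (d 0), Finset.sum_eq_single (d 1), if_pos he]
  · exact fun j _ hj => if_neg fun h => hj (hne h).2
  · intro h
    simp at h
    omega
  · exact fun i _ hi => Finset.sum_eq_zero fun j _ => if_neg fun h => hi (hne h).1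
  · intro h
    simp at h
    omega

/-- A polynomial of degree less than that of a separable polynomial `P` and vanishing at all
roots of `P` has zero coefficients. -/
theorem coeff_eq_zero_of_separable {K : Type*} [Field K] [IsAlgClosed K]
    {P : Polynomial K} (hP : P.Separable) {n : ℕ} (hn : P.natDegree = n) (r : Fin n → K)
    (h : ∀ t, P.eval t = 0 → ∑ i, r i * t ^ (i : ℕ) = 0) : r = 0 := by
  classical
  subst hn
  have hcard : Fintype.card (P.rootSet K) = P.natDegree :=
    Polynomial.card_rootSet_eq_natDegree hP (IsAlgClosed.splits _)
  let φ : Fin P.natDegree ≃ P.rootSet K := (Fintype.equivFinOfCardEq hcard).symm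
  refine Matrix.eq_zero_of_forall_index_sum_mul_pow_eq_zero
    (Subtype.val_injective.comp φ.injective) fun j => h _ ?_
  simpa using (Polynomial.mem_rootSet.1 (φ j).2).2

/-- The octic whose roots are the parameters of the base points on the nodal cubic `h₁ = 0`
with parametrization `t ↦ (t² - 1, 1 - t + t³, 1)`. -/
noncomputable def baseOctic : Polynomial ℂ :=
  -2 * .X ^ 8 + 8 * .X ^ 6 - 2 * .X ^ 5 - 11 * .X ^ 4 + 6 * .X ^ 3 + 6 * .X ^ 2 - 4 * .X

theorem baseOctic_natDegree : baseOctic.natDegree = 8 := by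
  unfold baseOctic
  compute_degree!

theorem baseOctic_eval (t : ℂ) : baseOctic.eval t =
    -2 * t ^ 8 + 8 * t ^ 6 - 2 * t ^ 5 - 11 * t ^ 4 + 6 * t ^ 3 + 6 * t ^ 2 - 4 * t := by
  simp [baseOctic]

theorem baseOctic_separable : baseOctic.Separable := by
  have hder : Polynomial.derivative baseOctic =
      -16 * .X ^ 7 + 48 * .X ^ 5 - 10 * .X ^ 4 - 44 * .X ^ 3 + 18 * .X ^ 2 + 12 * .X - 4 := by
    simp [baseOctic, Polynomial.derivative_pow, Polynomial.C_ofNat]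
    ring
  have hC : (Polynomial.C (52528 : ℂ)⁻¹) * 52528 = 1 := by
    rw [← Polynomial.C_ofNat, ← Polynomial.C_mul]
    norm_num
  refine ⟨Polynomial.C (52528 : ℂ)⁻¹ * (190448 * .X ^ 6 + 135264 * .X ^ 5 - 504048 * .X ^ 4
    - 224554 * .X ^ 3 + 448688 * .X ^ 2 - 2202 * .X - 118744),
    Polynomial.C (52528 : ℂ)⁻¹ * (-23806 * .X ^ 7 - 16908 * .X ^ 6 + 86812 * .X ^ 5
    + 36050 * .X ^ 4 - 119481 * .X ^ 3 + 3036 * .X ^ 2 + 79348 * .X - 13132), ?_⟩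
  rw [hder, baseOctic]
  linear_combination hC

/-- The points of `h₁ = 0` whose parameter is a root of `baseOctic` are base points of the
pencil `⟨h₁, h₂⟩` other than `(0,1,0)`. -/
theorem eval_eq_zero_of_baseOctic {f : MvPolynomial (Fin 3) ℂ}
    (hbase : ∀ p : Fin 3 → ℂ, p ≠ 0 → MvPolynomial.eval p h₁ = 0 →
      MvPolynomial.eval p h₂ = 0 → (∀ c : ℂ, p ≠ c • ![0, 1, 0]) →
      MvPolynomial.eval p f = 0) {t : ℂ} (ht : baseOctic.eval t = 0) :
    MvPolynomial.eval ![t ^ 2 - 1, 1 - t + t ^ 3, 1] f = 0 := by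
  rw [baseOctic_eval] at ht
  refine hbase _ (fun h => by simpa using congrFun h 2) ?_ ?_
    (fun c h => by simpa using congrFun h 2)
  · simp [h₁]
    ring
  · simp [h₂]
    linear_combination ht

/-- Every homogeneous quartic vanishing at the eight base points of the pencil `⟨h₁, h₂⟩` other
than `(0,1,0)`, to order `≥ 2` at `(4,9,6)`, at `(0,1,1)`, and to order `≥ 2` at `(0,0,1)`,
is zero (the computation `h⁰₁₁,₉ = 0`). -/
theorem degree_four_vanishing_h0_11_9
    (f : MvPolynomial (Fin 3) ℂ)
    (hf : f.IsHomogeneous 4)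
    (hbase : ∀ p : Fin 3 → ℂ, p ≠ 0 → MvPolynomial.eval p h₁ = 0 →
      MvPolynomial.eval p h₂ = 0 → (∀ c : ℂ, p ≠ c • ![0, 1, 0]) →
      MvPolynomial.eval p f = 0)
    (hE0 : VanishesToOrder f ![4, 9, 6] 2)
    (hB1 : MvPolynomial.eval ![0, 1, 1] f = 0)
    (hB2 : VanishesToOrder f ![0, 0, 1] 2) :
    f = 0 := by
  have hpts (t : ℂ) (ht : baseOctic.eval t = 0) := eval_eq_zero_of_baseOctic hbase ht
  clear hbase
  obtain ⟨c, rfl⟩ := isHomogeneous_fin_three_eq_sum hf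
  clear hf
  have hE (i : Fin 3) := hE0 [i] (by simp)
  have hN (i : Fin 3) := hB2 [i] (by simp)
  clear hE0 hB2
  have hE0 := hE 0
  have hE1 := hE 1
  have hE2 := hE 2
  have hN0 := hN 0
  have hN1 := hN 1
  have hN2 := hN 2
  clear hE hN
  simp [Finset.sum_range_succ, Derivation.leibniz, Derivation.leibniz_pow, pderiv_X]
    at hE0 hE1 hE2 hN0 hN1 hN2 hB1 hpts ⊢
  simp only [hN0, hN1, hN2, map_zero, zero_mul, zero_add] at *
  have hr := coeff_eq_zero_of_separable baseOctic_separable baseOctic_natDegree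
    ![c 0 2 + c 0 3 + c 0 4 - c 1 1 - c 1 2 - c 1 3 + c 2 0 + c 2 1 + c 2 2 - c 3 0 - c 3 1
      + c 4 0,
      -2 * c 0 2 - 3 * c 0 3 - 5 * c 0 4 + c 1 1 - c 1 3 - c 2 1 - 2 * c 2 2 + c 3 1 - 2 * c 4 0,
      c 0 2 + c 0 3 + 3/2 * c 0 4 + c 1 1 + 3 * c 1 2 + 4 * c 1 3 - 2 * c 2 0 - 2 * c 2 1
        - c 2 2 + 3 * c 3 0 + c 3 1 - c 4 0,
      2 * c 0 2 + 5 * c 0 3 + 21/2 * c 0 4 - 2 * c 1 1 - c 1 2 + c 1 3 + 3 * c 2 1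
        + 4 * c 2 2 - c 3 1 + 3 * c 4 0,
      -2 * c 0 2 - 3 * c 0 3 - 19/4 * c 0 4 - 5/2 * c 1 2 - 4 * c 1 3 + c 2 0 + c 2 1
        - 3 * c 3 0 + 1/2 * c 4 0,
      -5/2 * c 0 3 - 7 * c 0 4 + c 1 1 + c 1 2 - 3 * c 2 1 - 3 * c 2 2 + 1/2 * c 3 1 - c 4 0,
      c 0 2 + 2 * c 0 3 + 4 * c 0 4 + c 1 2 + 2 * c 1 3 + 1/2 * c 2 2 + c 3 0,
      c 0 3 + 3 * c 0 4 + 1/2 * c 1 3 + c 2 1 + c 2 2]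
    fun t ht => by
      simp [Fin.sum_univ_eight]
      linear_combination hpts t ht
        - ((-1/4 * c 0 4 - 1/2 * c 1 2 - c 1 3 - 1/2 * c 4 0) + (-1/2 * c 0 3 - 3/2 * c 0 4
        - 1/2 * c 3 1) * t + (-1/2 * c 2 2) * t ^ 2 + (-1/2 * c 1 3) * t ^ 3
        + (-1/2 * c 0 4) * t ^ 4) * (baseOctic_eval t).symm.trans ht
  have hr0 := congrFun hr 0
  have hr1 := congrFun hr 1
  have hr2 := congrFun hr 2
  have hr3 := congrFun hr 3
  have hr4 := congrFun hr 4
  have hr5 := congrFun hr 5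
  have hr6 := congrFun hr 6
  have hr7 := congrFun hr 7
  simp at hr0 hr1 hr2 hr3 hr4 hr5 hr6 hr7
  have hc : c 0 2 = 0 ∧ c 0 3 = 0 ∧ c 0 4 = 0 ∧ c 1 1 = 0 ∧ c 1 2 = 0 ∧ c 1 3 = 0 ∧ c 2 0 = 0 ∧
      c 2 1 = 0 ∧ c 2 2 = 0 ∧ c 3 0 = 0 ∧ c 3 1 = 0 ∧ c 4 0 = 0 := by
    refine ⟨?_, ?_, ?_, ?_, ?_, ?_, ?_, ?_, ?_, ?_, ?_, ?_⟩ <;> grind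
  simp [hc]
end

section
/- Let h₁ = (y−z)²z − x³ − x²z and h₂ = x³ − 2xy² + 2xyz + y²z in ℂ[x,y,z]. Every homogeneous polynomial f of degree 5 in ℂ[x,y,z] satisfying all of the following conditions is the zero polynomial: (i) f(a,b,c) = 0 for every nonzero (a,b,c) ∈ ℂ³ with h₁(a,b,c) = h₂(a,b,c) = 0; (ii) every iterated partial derivative of f of total order < 2 vanishes at (4,9,6); (iii) every iterated partial derivative of f of total order < 3 vanishes at (0,1,1); (iv) every iterated partial derivative of f of total order < 2 vanishes at (0,0,1). -/
open MvPolynomial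

/-- Coordinates of a homogeneous polynomial in the monomial basis. -/
theorem MvPolynomial.IsHomogeneous.exists_eq_sum_antidiagonalTuple {R : Type*} [CommSemiring R]
    {k n : ℕ} {f : MvPolynomial (Fin k) R} (hf : f.IsHomogeneous n) :
    ∃ c : (Fin k → ℕ) → R,
      f = ∑ v ∈ Finset.Nat.antidiagonalTuple k n, C (c v) * ∏ i, X i ^ v i := by
  refine ⟨fun v => f.coeff (Finsupp.equivFunOnFinite.symm v), ?_⟩
  have hsupp : f.support.map Finsupp.equivFunOnFinite.toEmbedding ⊆
      Finset.Nat.antidiagonalTuple k n := by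
    intro v hv
    obtain ⟨d, hd, rfl⟩ := Finset.mem_map.1 hv
    rw [Finset.Nat.mem_antidiagonalTuple]
    have := hf.degree_eq_sum_deg_support hd
    rw [this]
    exact (Finset.sum_subset (Finset.subset_univ _) (by simp)).symm
  rw [← Finset.sum_subset hsupp, Finset.sum_map]
  · conv_lhs => rw [f.as_sum]
    refine Finset.sum_congr rfl fun d _ => ?_
    rw [monomial_eq, Finsupp.prod_fintype _ _ (by simp)]
    simp
  · intro v _ hv
    have : f.coeff (Finsupp.equivFunOnFinite.symm v) = 0 := by
      by_contra h
      exact hv (Finset.mem_map.2 ⟨_, mem_support_iff.2 h, by simp⟩)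
    simp [this]

/-- Over an algebraically closed field, a separable polynomial divides every polynomial that
vanishes at all of its roots. -/
theorem Polynomial.Separable.dvd_of_forall_isRoot {k : Type*} [Field k] [IsAlgClosed k]
    {p q : Polynomial k} (hp : p.Separable) (h : ∀ x, p.IsRoot x → q.IsRoot x) : p ∣ q := by
  rcases eq_or_ne q 0 with rfl | hq
  · exact dvd_zero p
  · rw [IsAlgClosed.dvd_iff_roots_le_roots hp.ne_zero hq,
      Multiset.le_iff_subset (Polynomial.nodup_roots hp)]
    intro x hx
    exact (Polynomial.mem_roots hq).2 (h x (Polynomial.isRoot_of_mem_roots hx))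

/-- The restriction of `h₂` to the nodal cubic `h₁ = 0`, parametrised in the chart `z = 1` by
`t ↦ (t² - 1, t³ - t + 1, 1)`. -/
noncomputable def restrictedCubic : Polynomial ℂ :=
  -2 * Polynomial.X ^ 8 + 8 * Polynomial.X ^ 6 - 2 * Polynomial.X ^ 5 - 11 * Polynomial.X ^ 4
    + 6 * Polynomial.X ^ 3 + 6 * Polynomial.X ^ 2 - 4 * Polynomial.X

theorem eval_nodalParam_h₁ (t : ℂ) : eval ![t ^ 2 - 1, t ^ 3 - t + 1, 1] h₁ = 0 := by
  simp [h₁]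
  ring

theorem eval_nodalParam_h₂ (t : ℂ) :
    eval ![t ^ 2 - 1, t ^ 3 - t + 1, 1] h₂ = restrictedCubic.eval t := by
  simp [h₂, restrictedCubic]
  ring

theorem natDegree_restrictedCubic : restrictedCubic.natDegree = 8 := by
  unfold restrictedCubic
  compute_degree!

theorem separable_restrictedCubic : restrictedCubic.Separable := by
  rw [restrictedCubic, Polynomial.separable_def]
  have hC : Polynomial.C (1 / 52528 : ℂ) * 52528 = 1 := by
    rw [← Polynomial.C_ofNat, ← Polynomial.C_mul]
    norm_num
  generalize Polynomial.C (1 / 52528 : ℂ) = w at hC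
  refine ⟨w * (-118744 - 2202 * Polynomial.X + 448688 * Polynomial.X ^ 2
      - 224554 * Polynomial.X ^ 3 - 504048 * Polynomial.X ^ 4 + 135264 * Polynomial.X ^ 5
      + 190448 * Polynomial.X ^ 6),
    w * (-13132 + 79348 * Polynomial.X + 3036 * Polynomial.X ^ 2
      - 119481 * Polynomial.X ^ 3 + 36050 * Polynomial.X ^ 4 + 86812 * Polynomial.X ^ 5
      - 16908 * Polynomial.X ^ 6 - 23806 * Polynomial.X ^ 7), ?_⟩
  simp [Polynomial.C_ofNat]
  linear_combination hC

/-- A polynomial of degree at most `8` vanishing at the roots of `restrictedCubic` is a scalar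
multiple of it. -/
theorem exists_coeff_eq_mul_coeff_restrictedCubic (h : Fin 9 → ℂ)
    (hroot : ∀ t, restrictedCubic.eval t = 0 → ∑ i, h i * t ^ (i : ℕ) = 0) :
    ∃ r, ∀ i : Fin 9, h i = r * restrictedCubic.coeff i := by
  set p : Polynomial ℂ := ∑ i, Polynomial.C (h i) * Polynomial.X ^ (i : ℕ) with hp
  have hdvd : restrictedCubic ∣ p :=
    separable_restrictedCubic.dvd_of_forall_isRoot fun t ht => by
      simpa [hp, Polynomial.IsRoot, Polynomial.eval_finsetSum] using hroot t ht
  have hdeg : p.natDegree ≤ restrictedCubic.natDegree := by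
    rw [natDegree_restrictedCubic]
    exact Polynomial.natDegree_sum_le_of_forall_le _ _ fun i _ =>
      (Polynomial.natDegree_C_mul_X_pow_le _ _).trans (by omega)
  obtain ⟨q, hq⟩ := hdvd
  have hq0 : q.natDegree = 0 := by
    rcases eq_or_ne q 0 with rfl | hne
    · simp
    · rw [hq, Polynomial.natDegree_mul separable_restrictedCubic.ne_zero hne] at hdeg
      omega
  rw [Polynomial.eq_C_of_natDegree_eq_zero hq0] at hq
  refine ⟨q.coeff 0, fun i => ?_⟩
  have hi : p.coeff i = h i := by
    simp [hp, Polynomial.coeff_X_pow, Fin.val_inj]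
  rw [← hi, hq, Polynomial.coeff_mul_C, mul_comm]

/-- Coordinates of a homogeneous polynomial in the monomials in `x`, `y - z`, `z`. -/
theorem MvPolynomial.IsHomogeneous.exists_eq_sum_shifted {R : Type*} [CommRing R]
    {n : ℕ} {f : MvPolynomial (Fin 3) R} (hf : f.IsHomogeneous n) :
    ∃ c : (Fin 3 → ℕ) → R, f = ∑ v ∈ Finset.Nat.antidiagonalTuple 3 n,
      C (c v) * (X 0 ^ v 0 * (X 1 - X 2) ^ v 1 * X 2 ^ v 2) := by
  have hg : (MvPolynomial.aeval ![X 0, X 1 + X 2, X 2] f : MvPolynomial (Fin 3) R).IsHomogeneous n := by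
    simpa only [one_mul] using hf.aeval (n := 1) ![X 0, X 1 + X 2, X 2] fun i => by
      fin_cases i
      · exact isHomogeneous_X _ _
      · exact (isHomogeneous_X _ _).add (isHomogeneous_X _ _)
      · exact isHomogeneous_X _ _
  obtain ⟨c, hc⟩ := hg.exists_eq_sum_antidiagonalTuple
  refine ⟨c, ?_⟩
  have hinv : (MvPolynomial.aeval ![X 0, X 1 - X 2, X 2]).comp
      (MvPolynomial.aeval ![X 0, X 1 + X 2, X 2]) =
      AlgHom.id R (MvPolynomial (Fin 3) R) := by
    ext i : 1
    fin_cases i <;> simp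
  have h := congrArg
    (MvPolynomial.aeval (![X 0, X 1 - X 2, X 2] : Fin 3 → MvPolynomial (Fin 3) R)) hc
  rw [← AlgHom.comp_apply, hinv, AlgHom.id_apply] at h
  simpa [Fin.prod_univ_three, algebraMap_eq] using h

/-- Every homogeneous quintic vanishing at all nine base points of the pencil `⟨h₁, h₂⟩`, to
order `≥ 2` at `(4,9,6)`, to order `≥ 3` at `(0,1,1)` and to order `≥ 2` at `(0,0,1)`, is
zero (the computation `h⁰₁₁,₁₀ = 0`). -/
theorem degree_five_vanishing_h0_11_10
    (f : MvPolynomial (Fin 3) ℂ)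
    (hf : f.IsHomogeneous 5)
    (hbase : ∀ p : Fin 3 → ℂ, p ≠ 0 → MvPolynomial.eval p h₁ = 0 →
      MvPolynomial.eval p h₂ = 0 → MvPolynomial.eval p f = 0)
    (hE0 : VanishesToOrder f ![4, 9, 6] 2)
    (hB1 : VanishesToOrder f ![0, 1, 1] 3)
    (hB2 : VanishesToOrder f ![0, 0, 1] 2) :
    f = 0 := by
  have hinf : eval ![0, 1, 0] f = 0 :=
    hbase _ (fun h => one_ne_zero (congr_fun h 1)) (by simp [h₁]) (by simp [h₂])
  have hcurve (t : ℂ) (ht : restrictedCubic.eval t = 0) :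
      eval ![t ^ 2 - 1, t ^ 3 - t + 1, 1] f = 0 :=
    hbase _ (fun h => one_ne_zero (congr_fun h 2)) (eval_nodalParam_h₁ t)
      ((eval_nodalParam_h₂ t).trans ht)
  obtain ⟨c, hc⟩ := hf.exists_eq_sum_shifted
  simp [Finset.sum, Finset.Nat.antidiagonalTuple, Multiset.Nat.antidiagonalTuple,
    List.Nat.antidiagonalTuple] at hc
  generalize c ![0, 0, 5] = a00 at hc
  generalize c ![0, 1, 4] = a01 at hc
  generalize c ![0, 2, 3] = a02 at hc
  generalize c ![0, 3, 2] = a03 at hc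
  generalize c ![0, 4, 1] = a04 at hc
  generalize c ![0, 5, 0] = a05 at hc
  generalize c ![1, 0, 4] = a10 at hc
  generalize c ![1, 1, 3] = a11 at hc
  generalize c ![1, 2, 2] = a12 at hc
  generalize c ![1, 3, 1] = a13 at hc
  generalize c ![1, 4, 0] = a14 at hc
  generalize c ![2, 0, 3] = a20 at hc
  generalize c ![2, 1, 2] = a21 at hc
  generalize c ![2, 2, 1] = a22 at hc
  generalize c ![2, 3, 0] = a23 at hc
  generalize c ![3, 0, 2] = a30 at hc
  generalize c ![3, 1, 1] = a31 at hc
  generalize c ![3, 2, 0] = a32 at hc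
  generalize c ![4, 0, 1] = a40 at hc
  generalize c ![4, 1, 0] = a41 at hc
  generalize c ![5, 0, 0] = a50 at hc
  have hN := hB1 [] (by simp)
  have hN0 := hB1 [0] (by simp)
  have hN1 := hB1 [1] (by simp)
  simp [hc] at hN
  subst hN
  simp [hc, pderiv_X] at hN0 hN1 hinf
  subst hN0 hN1 hinf
  have hN00 := hB1 [0, 0] (by simp)
  have hN01 := hB1 [0, 1] (by simp)
  have hN11 := hB1 [1, 1] (by simp)
  simp [hc, pderiv_X] at hN00 hN01 hN11
  subst hN00 hN01 hN11
  have hE0' := hE0 [0] (by simp)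
  have hE1 := hE0 [1] (by simp)
  have hE2 := hE0 [2] (by simp)
  have hM0 := hB2 [0] (by simp)
  have hM1 := hB2 [1] (by simp)
  have hM2 := hB2 [2] (by simp)
  simp [hc, pderiv_X] at hE0' hE1 hE2 hM0 hM1 hM2
  ring_nf at hE0' hE1 hE2 hM0 hM1 hM2
  obtain ⟨r, hr⟩ := exists_coeff_eq_mul_coeff_restrictedCubic
    ![a30 - a40 + a50, a21 - a31 + a41, a12 - a22 + a40 + a32 - 2 * a50,
      a03 - a13 + a31 + a23 - 2 * a41, a22 - a04 + a14 - 2 * a32 + a50, a13 - 2 * a23 + a41,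
      a04 + a32 - 2 * a14, a23, a14] fun t ht => by
    have hft := hcurve t ht
    have hne : (t ^ 2 - 1) ^ 3 ≠ 0 := by
      intro h
      have h1 : t ^ 2 = 1 := by simpa [sub_eq_zero] using h
      simp [restrictedCubic] at ht
      grind
    refine (mul_eq_zero.1 ?_).resolve_left hne
    simp [hc] at hft
    simp only [Fin.sum_univ_succ, Finset.univ_eq_empty, Finset.sum_empty]
    simp [-mul_eq_zero]
    linear_combination hft
  simp [Fin.forall_fin_succ, restrictedCubic, Polynomial.coeff_X, Polynomial.coeff_X_pow] at hr
  obtain ⟨h0, h1, h2, h3, h4, h5, h6, h7, h8⟩ := hr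
  obtain rfl : a03 = 0 := by linear_combination -hM1 - 4 / 5 * hM2
  obtain rfl : a04 = 0 := by linear_combination hM2 / 5
  obtain rfl : a32 = 4 * r := by linear_combination h6 + 2 * h8
  obtain rfl : a12 = a13 + 2 * r := by linear_combination hM0 - h8
  obtain rfl : a41 = -2 * r - a13 := by linear_combination h5 + 2 * h7
  obtain rfl : a31 = 2 * r - a13 := by linear_combination h3 - h7
  obtain rfl : a21 = 0 := by linear_combination h1
  obtain rfl : a22 = -r - a50 := by linear_combination h4 - h8
  obtain rfl : a40 = -r - a13 + a50 := by linear_combination h2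
  obtain rfl : a30 = -r - a13 := by linear_combination h0
  subst h7 h8
  have e0 : -4410 * a13 - 1290 * r + 2384 * a50 = 0 := by linear_combination hE0'
  have e1 : 872 * a13 + 2080 * r - 576 * a50 = 0 := by linear_combination hE1
  have e2 : -1548 * a13 - 2000 * r + 688 * a50 = 0 := by linear_combination hE2
  obtain ⟨rfl, rfl, rfl⟩ : r = 0 ∧ a13 = 0 ∧ a50 = 0 := by grind
  simpa using hc
end

section
/- Let h₁ = (y−z)²z − x³ − x²z and h₂ = x³ − 2xy² + 2xyz + y²z in ℂ[x,y,z]. Every homogeneous polynomial f of degree 16 in ℂ[x,y,z] satisfying all of the following conditions is the zero polynomial: (i) for every nonzero (a,b,c) ∈ ℂ³ with h₁(a,b,c) = h₂(a,b,c) = 0, every iterated partial derivative of f of total order < 4 vanishes at (a,b,c); (ii) every iterated partial derivative of f of total order < 6 vanishes at (4,9,6); (iii) every iterated partial derivative of f of total order < 6 vanishes at (0,1,1); (iv) every iterated partial derivative of f of total order < 6 vanishes at (0,0,1). -/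
open MvPolynomial

/-- Gaussian elimination modulo `p` on `n` columns, each row being packed into one natural number
with its entries as base `B` digits. Returns `true` if every column has a pivot. -/
def hasTrivialKernel (B p : ℕ) : ℕ → List ℕ → Bool
  | 0, _ => true
  | n + 1, rows =>
    match rows.find? fun r => r % B % p != 0 with
    | none => false
    | some r => hasTrivialKernel B p n
        (rows.map fun s => r % B % p * (s / B) + (p - s % B % p) * (r / B))

section Elimination

variable {κ : Type*} [Field κ]

/-- The value of the linear form with coefficient list `r` at the vector `v`. -/
def linearForm (r : List ℕ) (v : List κ) : κ :=
  (List.zipWith (fun (a : ℕ) x => (a : κ) * x) r v).sum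

theorem linearForm_cons (a : ℕ) (r : List ℕ) (x : κ) (v : List κ) :
    linearForm (a :: r) (x :: v) = a * x + linearForm r v := by
  simp [linearForm]

theorem linearForm_zipWith (h g : ℕ) (v : List κ) (s t : List ℕ)
    (hs : s.length = v.length) (ht : t.length = v.length) :
    linearForm (List.zipWith (fun a b => h * a + g * b) s t) v =
      h * linearForm s v + g * linearForm t v := by
  induction v generalizing s t with
  | nil => simp [linearForm]
  | cons x v ih =>
    obtain ⟨a, s, rfl⟩ := List.exists_cons_of_length_eq_add_one hs
    obtain ⟨b, t, rfl⟩ := List.exists_cons_of_length_eq_add_one ht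
    rw [List.zipWith_cons_cons, linearForm_cons, linearForm_cons, linearForm_cons,
      ih s t (by simpa using hs) (by simpa using ht)]
    push_cast
    ring

theorem ofDigits_zipWith (B h g n : ℕ) (s t : List ℕ) (hs : s.length = n) (ht : t.length = n) :
    Nat.ofDigits B (List.zipWith (fun a b => h * a + g * b) s t) =
      h * Nat.ofDigits B s + g * Nat.ofDigits B t := by
  induction n generalizing s t with
  | zero => simp_all
  | succ n ih =>
    obtain ⟨a, s, rfl⟩ := List.exists_cons_of_length_eq_add_one hs
    obtain ⟨b, t, rfl⟩ := List.exists_cons_of_length_eq_add_one ht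
    rw [List.zipWith_cons_cons, Nat.ofDigits_cons, Nat.ofDigits_cons, Nat.ofDigits_cons,
      ih s t (by simpa using hs) (by simpa using ht)]
    ring

theorem eq_zero_of_hasTrivialKernel (p : ℕ) [CharP κ p] (hp : 0 < p) (B n K : ℕ)
    (hK : K * (2 * p) ^ n ≤ B) (rows : List (List ℕ)) (v : List κ) (hv : v.length = n)
    (hlen : ∀ r ∈ rows, r.length = n) (hlt : ∀ r ∈ rows, ∀ a ∈ r, a < K)
    (hker : hasTrivialKernel B p n (rows.map (Nat.ofDigits B)) = true)
    (hform : ∀ r ∈ rows, linearForm r v = 0) : ∀ x ∈ v, x = 0 := by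
  induction n generalizing K rows v with
  | zero => simp_all
  | succ n ih =>
    obtain ⟨x, v, rfl⟩ := List.exists_cons_of_length_eq_add_one hv
    have hKB : K ≤ B := (Nat.le_mul_of_pos_right K (by positivity)).trans hK
    have key : ∀ r ∈ rows, ∃ a t, r = a :: t ∧ t.length = n ∧ (∀ b ∈ t, b < K) ∧
        Nat.ofDigits B r % B = a ∧ Nat.ofDigits B r / B = Nat.ofDigits B t := by
      intro r hr
      obtain ⟨a, t, rfl⟩ := List.exists_cons_of_length_eq_add_one (hlen r hr)
      have ha : a < B := (hlt _ hr a (by simp)).trans_le hKB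
      refine ⟨a, t, rfl, by simpa using hlen _ hr, fun b hb => hlt _ hr b (by simp [hb]), ?_, ?_⟩
      · rw [Nat.ofDigits_cons, Nat.add_mul_mod_self_left, Nat.mod_eq_of_lt ha]
      · rw [Nat.ofDigits_cons, Nat.add_mul_div_left _ _ (by omega),
          Nat.div_eq_of_lt ha, zero_add]
    rw [hasTrivialKernel, List.find?_map] at hker
    cases hfind : rows.find? ((fun r => r % B % p != 0) ∘ Nat.ofDigits B) with
    | none => simp only [hfind, Option.map_none, Bool.false_eq_true] at hker
    | some r =>
      have hr := List.mem_of_find?_eq_some hfind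
      have hpiv := List.find?_some hfind
      obtain ⟨h, t, rfl, ht, htK, hmod, hdiv⟩ := key r hr
      simp only [hfind, Option.map_some, List.map_map, hmod, hdiv] at hker
      simp only [Function.comp_apply, hmod, bne_iff_ne, ne_eq] at hpiv
      have hh : (h : κ) ≠ 0 := by
        rwa [Ne, CharP.cast_eq_zero_iff κ p, Nat.dvd_iff_mod_eq_zero]
      let reduce : List ℕ → List ℕ := fun s =>
        List.zipWith (fun a b => h % p * a + (p - s.headD 0 % p) * b) s.tail t
      have hrows : rows.map ((fun s => h % p * (s / B) + (p - s % B % p) * Nat.ofDigits B t) ∘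
          Nat.ofDigits B) = (rows.map reduce).map (Nat.ofDigits B) := by
        rw [List.map_map]
        refine List.map_congr_left fun s hs => ?_
        obtain ⟨g, s, rfl, hsn, -, hmod', hdiv'⟩ := key s hs
        simp only [Function.comp_apply, hmod', hdiv', reduce, List.headD_cons, List.tail_cons]
        rw [ofDigits_zipWith B _ _ n s t hsn ht]
      have hvn : v.length = n := by simpa using hv
      have hv0 : ∀ y ∈ v, y = 0 := by
        refine ih (K * (2 * p)) (by rwa [mul_assoc, ← pow_succ']) (rows.map reduce) v hvn
          ?_ ?_ (hrows ▸ hker) ?_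
        · intro s' hs'
          obtain ⟨s, hs, rfl⟩ := List.mem_map.1 hs'
          simp [reduce, hlen s hs, ht]
        · intro s' hs' c hc
          obtain ⟨s, hs, rfl⟩ := List.mem_map.1 hs'
          obtain ⟨g, s, rfl, hsn, hsK, -, -⟩ := key s hs
          simp only [reduce, List.tail_cons, List.headD_cons] at hc
          obtain ⟨i, hi, rfl⟩ := List.mem_iff_getElem.1 hc
          rw [List.getElem_zipWith]
          have h1 := hsK _ (List.getElem_mem (l := s) (n := i) (by simp at hi; omega))
          have h2 := htK _ (List.getElem_mem (l := t) (n := i) (by simp at hi; omega))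
          have h3 : h % p < p := Nat.mod_lt _ hp
          have h4 : p - g % p ≤ p := Nat.sub_le _ _
          nlinarith [Nat.mul_le_mul h3.le h1.le, Nat.mul_le_mul h4 h2.le,
            Nat.mul_lt_mul_of_lt_of_le h3 h1.le (by omega)]
        · intro s' hs'
          obtain ⟨s, hs, rfl⟩ := List.mem_map.1 hs'
          obtain ⟨g, s, rfl, hsn, -, -, -⟩ := key s hs
          have e1 := hform _ hs
          have e2 := hform _ hr
          rw [linearForm_cons] at e1 e2
          simp only [reduce, List.tail_cons, List.headD_cons]
          rw [linearForm_zipWith _ _ _ _ _ (hsn.trans hvn.symm) (ht.trans hvn.symm),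
            Nat.cast_sub (Nat.mod_lt _ hp).le, ← CharP.cast_eq_mod κ p,
            ← CharP.cast_eq_mod κ p, CharP.cast_eq_zero κ p]
          linear_combination h * e1 - g * e2
      have hform0 : linearForm t v = 0 := by
        rw [List.eq_replicate_of_mem hv0]
        refine List.sum_eq_zero fun y hy => ?_
        obtain ⟨i, hi, rfl⟩ := List.mem_iff_getElem.1 hy
        simp
      have e := hform _ hr
      rw [linearForm_cons, hform0, add_zero, mul_eq_zero] at e
      exact List.forall_mem_cons.2 ⟨e.resolve_left hh, hv0⟩

end Elimination

/-- A square matrix over a subring of a field has trivial kernel over the field as soon as its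
reduction to some residue field has. -/
theorem eq_zero_of_reduction_mulVec {A K κ m n : Type*} [CommRing A] [Field K] [Field κ]
    [Fintype m] [Fintype n] [DecidableEq n] (hcard : Fintype.card m = Fintype.card n)
    (ψ : A →+* K) (hψ : Function.Injective ψ) (φ : A →+* κ) (M : Matrix m n A)
    (hκ : ∀ w : n → κ, (M.map φ).mulVec w = 0 → w = 0)
    (v : n → K) (hv : (M.map ψ).mulVec v = 0) : v = 0 := by
  let e : n ≃ m := (Fintype.equivOfCardEq hcard).symm
  let N : Matrix n n A := M.submatrix e id
  have hdet : (N.map φ).det ≠ 0 := by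
    intro h
    obtain ⟨w, hw, hw0⟩ := Matrix.exists_mulVec_eq_zero_iff.2 h
    refine hw (hκ w (funext fun i => ?_))
    have := congrFun hw0 (e.symm i)
    simpa [N, Matrix.mulVec, dotProduct] using this
  have hdetK : (N.map ψ).det ≠ 0 := by
    have h1 : (N.map ψ).det = ψ N.det := (RingHom.map_det ψ N).symm
    have h2 : (N.map φ).det = φ N.det := (RingHom.map_det φ N).symm
    rw [h1, map_ne_zero_iff ψ hψ]
    rintro h
    simp [h2, h] at hdet
  refine Matrix.eq_zero_of_mulVec_eq_zero hdetK (funext fun i => ?_)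
  exact congrFun hv (e i)

/-- There is a ring homomorphism from the algebraic integers to a field of characteristic `p`
under which every root mod `p` of a monic integer polynomial `G` lifts to a root of `G`. -/
theorem exists_reduction_algebraicInteger (p : ℕ) [Fact p.Prime] :
    ∃ (κ : Type) (_ : Field κ) (_ : CharP κ p) (φ : integralClosure ℤ ℂ →+* κ),
      ∀ (G : Polynomial ℤ), G.Monic → ∀ n : ℕ, (p : ℤ) ∣ G.eval (n : ℤ) →
        ∃ u : integralClosure ℤ ℂ, Polynomial.aeval (u : ℂ) G = 0 ∧ φ u = n := by
  have hp : Prime (p : ℤ) := Nat.prime_iff_prime_int.1 Fact.out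
  have : (Ideal.span {(p : ℤ)}).IsMaximal :=
    PrincipalIdealRing.isMaximal_of_irreducible hp.irreducible
  have hinj : Function.Injective (algebraMap ℤ (integralClosure ℤ ℂ)) :=
    FaithfulSMul.algebraMap_injective _ _
  obtain ⟨Q, hQ, hQp⟩ := Ideal.exists_ideal_over_maximal_of_isIntegral
    (S := integralClosure ℤ ℂ) (Ideal.span {(p : ℤ)})
    (by rw [(RingHom.injective_iff_ker_eq_bot _).1 hinj]; exact bot_le)
  have hmem : ∀ a : ℤ, (p : ℤ) ∣ a → (a : integralClosure ℤ ℂ) ∈ Q := fun a ha => by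
    have : a ∈ Q.comap (algebraMap ℤ (integralClosure ℤ ℂ)) :=
      hQp ▸ Ideal.mem_span_singleton.2 ha
    simpa using this
  refine ⟨integralClosure ℤ ℂ ⧸ Q, Ideal.Quotient.field Q, ?_, Ideal.Quotient.mk Q, ?_⟩
  · refine (CharP.charP_iff_prime_eq_zero Fact.out).2 ?_
    have := Ideal.Quotient.eq_zero_iff_mem.2 (hmem p dvd_rfl)
    simpa using this
  · intro G hG n hn
    have hroot : ∀ r ∈ (G.map (algebraMap ℤ ℂ)).roots, r ∈ integralClosure ℤ ℂ := by
      intro r hr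
      refine ⟨G, hG, ?_⟩
      rw [← Polynomial.eval_map]
      exact (Polynomial.mem_roots'.1 hr).2
    obtain ⟨S, hS⟩ : ∃ S : Multiset (integralClosure ℤ ℂ),
        S.map (fun a : integralClosure ℤ ℂ => (a : ℂ)) = (G.map (algebraMap ℤ ℂ)).roots := by
      refine ⟨(G.map (algebraMap ℤ ℂ)).roots.attach.map fun r => ⟨r.1, hroot r.1 r.2⟩, ?_⟩
      simp [Multiset.map_map]
    have heval : ((G.eval (n : ℤ) : ℤ) : integralClosure ℤ ℂ) =
        (S.map fun a => (n : integralClosure ℤ ℂ) - a).prod := by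
      apply Subtype.val_injective
      have h := (IsAlgClosed.splits (G.map (algebraMap ℤ ℂ))).eval_eq_prod_roots_of_monic
        (hG.map _) ((n : ℤ) : ℂ)
      rw [← hS, Multiset.map_map, Polynomial.eval_intCast_map] at h
      simpa [Function.comp_def] using h
    have hprod := hmem _ hn
    rw [heval, hQ.isPrime.multiset_prod_mem_iff_exists_mem] at hprod
    obtain ⟨b, hb, hbQ⟩ := hprod
    obtain ⟨u, hu, rfl⟩ := Multiset.mem_map.1 hb
    refine ⟨u, ?_, ?_⟩
    · have hu' : (u : ℂ) ∈ (G.map (algebraMap ℤ ℂ)).roots := hS ▸ Multiset.mem_map_of_mem _ hu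
      simpa [Polynomial.aeval_def, Polynomial.eval_map] using (Polynomial.mem_roots'.1 hu').2
    · have := Ideal.Quotient.eq.2 hbQ
      rw [← this, map_natCast]

section Vanishing

theorem foldr_pderiv_add (L : List (Fin 3)) (f g : MvPolynomial (Fin 3) ℂ) :
    L.foldr (fun i h => pderiv i h) (f + g) =
      L.foldr (fun i h => pderiv i h) f + L.foldr (fun i h => pderiv i h) g := by
  induction L with
  | nil => rfl
  | cons i L ih => simp [ih]

theorem foldr_pderiv_C_mul (L : List (Fin 3)) (a : ℂ) (f : MvPolynomial (Fin 3) ℂ) :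
    L.foldr (fun i h => pderiv i h) (C a * f) = C a * L.foldr (fun i h => pderiv i h) f := by
  induction L with
  | nil => rfl
  | cons i L ih => simp [ih]

variable {f g : MvPolynomial (Fin 3) ℂ} {p : Fin 3 → ℂ} {m : ℕ}

theorem VanishesToOrder.add (hf : VanishesToOrder f p m) (hg : VanishesToOrder g p m) :
    VanishesToOrder (f + g) p m := fun L hL => by
  rw [foldr_pderiv_add, map_add, hf L hL, hg L hL, add_zero]

theorem VanishesToOrder.C_mul (a : ℂ) (hf : VanishesToOrder f p m) :
    VanishesToOrder (C a * f) p m := fun L hL => by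
  rw [foldr_pderiv_C_mul, map_mul, hf L hL, mul_zero]

theorem VanishesToOrder.derivative (i : Fin 3) (hf : VanishesToOrder f p (m + 1)) :
    VanishesToOrder (pderiv i f) p m := fun L hL => by
  simpa using hf (L ++ [i]) (by simpa using hL)

/-- The linear form with coefficients the `i`-th row of `A`. -/
noncomputable def rowForm (A : Matrix (Fin 3) (Fin 3) ℂ) (i : Fin 3) : MvPolynomial (Fin 3) ℂ :=
  ∑ j, C (A i j) * X j

theorem pderiv_bind₁_rowForm (A : Matrix (Fin 3) (Fin 3) ℂ) (j : Fin 3)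
    (f : MvPolynomial (Fin 3) ℂ) :
    pderiv j (bind₁ (rowForm A) f) = ∑ i, C (A i j) * bind₁ (rowForm A) (pderiv i f) := by
  have hX (i : Fin 3) : pderiv j (rowForm A i) = C (A i j) := by
    simp [rowForm, pderiv_X, Pi.single_apply]
  induction f using MvPolynomial.induction_on with
  | C a => simp
  | add f g hf hg => simp [hf, hg, mul_add, Finset.sum_add_distrib]
  | mul_X f k hf =>
    simp only [map_mul, bind₁_X_right, pderiv_mul, hf, hX, map_add, pderiv_X, Pi.single_apply,
      mul_add, Finset.sum_add_distrib]
    congr 1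
    · rw [Finset.sum_mul]
      simp [mul_assoc]
    · simp [mul_comm]

theorem VanishesToOrder.bind₁_rowForm (A : Matrix (Fin 3) (Fin 3) ℂ) (q : Fin 3 → ℂ)
    (hf : VanishesToOrder f (A.mulVec q) m) : VanishesToOrder (bind₁ (rowForm A) f) q m := by
  induction m generalizing f with
  | zero => intro L hL; simp at hL
  | succ m ih =>
    intro L hL
    rcases List.eq_nil_or_concat L with rfl | ⟨L, j, rfl⟩
    · have h0 := hf [] (by simp)
      have hA : (fun i => eval q (rowForm A i)) = A.mulVec q := by
        ext i; simp [rowForm, Matrix.mulVec, dotProduct]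
      refine (eval₂Hom_bind₁ _ _ _ _).trans ?_
      change eval (fun i => eval q (rowForm A i)) f = 0
      rw [hA]
      exact h0
    · have hsum : VanishesToOrder (pderiv j (bind₁ (rowForm A) f)) q m := by
        rw [pderiv_bind₁_rowForm, Fin.sum_univ_three]
        exact (((ih (hf.derivative 0)).C_mul _).add ((ih (hf.derivative 1)).C_mul _)).add
          ((ih (hf.derivative 2)).C_mul _)
      simpa using hsum L (by simpa using hL)

theorem foldr_pderiv_replicate_monomial (i : Fin 3) (k : ℕ) (d : Fin 3 →₀ ℕ) (a : ℂ) :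
    (List.replicate k i).foldr (fun i h => pderiv i h) (monomial d a) =
      monomial (d - Finsupp.single i k) (a * (d i).descFactorial k) := by
  induction k with
  | zero => simp
  | succ k ih =>
    rw [List.replicate_succ, List.foldr_cons, ih, pderiv_monomial, tsub_tsub,
      ← Finsupp.single_add, Nat.descFactorial_succ]
    simp [mul_left_comm, mul_comm]

theorem foldr_pderiv_sum (L : List (Fin 3)) {ι : Type*} (s : Finset ι)
    (F : ι → MvPolynomial (Fin 3) ℂ) :
    L.foldr (fun i h => pderiv i h) (∑ d ∈ s, F d) =
      ∑ d ∈ s, L.foldr (fun i h => pderiv i h) (F d) := by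
  induction L with
  | nil => rfl
  | cons i L ih => simp [ih]

/-- A linear condition on the coefficients imposed by a mixed partial derivative. -/
theorem VanishesToOrder.sum_coeff_eq_zero (hf : VanishesToOrder f p m) (l : Fin 3 → ℕ)
    (hl : l 0 + l 1 + l 2 < m) :
    ∑ d ∈ f.support, coeff d f * ∏ i, ((d i).descFactorial (l i) * p i ^ (d i - l i)) = 0 := by
  have h := hf (List.replicate (l 0) 0 ++ (List.replicate (l 1) 1 ++ List.replicate (l 2) 2))
    (by simp; omega)
  conv at h => enter [1, 2, 2]; rw [f.as_sum]
  rw [foldr_pderiv_sum, map_sum] at h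
  rw [← h]
  refine Finset.sum_congr rfl fun d _ => ?_
  simp only [List.foldr_append, foldr_pderiv_replicate_monomial, eval_monomial]
  rw [Finsupp.prod_fintype _ _ (by simp)]
  simp [Fin.prod_univ_three, Finsupp.single_apply]
  ring

theorem VanishesToOrder.coeff_eq_zero_of_isHomogeneous {n : ℕ} (hn : f.IsHomogeneous n)
    (i : Fin 3) (hf : VanishesToOrder f (Pi.single i 1) m) (d : Fin 3 →₀ ℕ) (hd : n < d i + m) :
    coeff d f = 0 := by
  by_contra hne
  have hdeg := hn hne
  rw [Finsupp.weight_apply, Finsupp.sum_fintype _ _ (by simp), Fin.sum_univ_three] at hdeg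
  simp only [Pi.one_apply, smul_eq_mul, mul_one] at hdeg
  have h := hf.sum_coeff_eq_zero (Function.update d i 0) (by
    fin_cases i <;> simp at hd ⊢ <;> omega)
  rw [Finset.sum_eq_single d] at h
  · rw [mul_eq_zero, or_iff_right hne, Finset.prod_eq_zero_iff] at h
    obtain ⟨j, -, hj⟩ := h
    by_cases hij : j = i
    · subst hij; simp at hj
    · simp [hij, Nat.descFactorial_self, Nat.factorial_ne_zero] at hj
  · intro e he hed
    have hedeg := hn (mem_support_iff.1 he)
    rw [Finsupp.weight_apply, Finsupp.sum_fintype _ _ (by simp), Fin.sum_univ_three] at hedeg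
    simp only [Pi.one_apply, smul_eq_mul, mul_one] at hedeg
    obtain ⟨j, hij, hj⟩ : ∃ j, j ≠ i ∧ e j ≠ d j := by
      by_contra! hall
      refine hed (Finsupp.ext fun j => ?_)
      by_cases hij : j = i
      · subst hij
        have h0 := hall 0
        have h1 := hall 1
        have h2 := hall 2
        fin_cases j <;> simp at h0 h1 h2 ⊢ <;> omega
      · exact hall j hij
    refine mul_eq_zero_of_right _ (Finset.prod_eq_zero (Finset.mem_univ j) ?_)
    rw [Function.update_of_ne hij, Pi.single_eq_of_ne hij]
    rcases lt_or_gt_of_ne hj with hlt | hgt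
    · simp [Nat.descFactorial_of_lt hlt]
    · rw [zero_pow (by omega), mul_zero]
  · intro h
    simp [notMem_support_iff.1 h]

end Vanishing

/-- The coefficient of the monomial with exponents `d` in the value of the iterated derivative of
order `l` at the base point with parameter `u`. The argument `m` stands for `-1`, so that the
expression also makes sense for natural numbers modulo a prime. -/
def conditionEntry {R : Type*} [CommSemiring R] (m u : R) (l d : ℕ × ℕ × ℕ) : R :=
  let x := u * (2 * u + 1)
  let y := u ^ 3 + (u + 1) * (2 * u + 1)
  let z := u ^ 3
  (d.1.descFactorial l.1 * x ^ (d.1 - l.1)) *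
    (d.2.1.descFactorial l.2.1 * (4 * y + 9 * m * x) ^ (d.2.1 - l.2.1)) *
    (d.2.2.descFactorial l.2.2 * (4 * z + 4 * m * y + 3 * x) ^ (d.2.2 - l.2.2))

/-- The exponents of the monomials of degree 16 of degree at most 10 in each variable. -/
def monomialExponents : List (ℕ × ℕ × ℕ) :=
  ((List.range 11 ×ˢ List.range 11).filter fun e => 6 ≤ e.1 + e.2 ∧ e.1 + e.2 ≤ 16).map
    fun e => (e.1, e.2, 16 - e.1 - e.2)

/-- The multi-indices of total order three. -/
def derivativeOrders : List (ℕ × ℕ × ℕ) :=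
  [(3, 0, 0), (2, 1, 0), (2, 0, 1), (1, 2, 0), (1, 1, 1), (1, 0, 2), (0, 3, 0), (0, 2, 1),
    (0, 1, 2), (0, 0, 3)]

/-- The roots modulo 911 of the polynomial cutting out the parameters of the base points. -/
def rootsMod : List ℕ := [0, 11, 177, 285, 384, 544, 593, 736, 910]

/-- The linear conditions imposed by the nine base points, reduced modulo 911. -/
def conditionRows : List (List ℕ) :=
  (rootsMod ×ˢ derivativeOrders).map fun r =>
    monomialExponents.map fun d => conditionEntry 910 r.1 r.2 d % 911

theorem hasTrivialKernel_conditionRows :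
    hasTrivialKernel (2 ^ 1024) 911 90 (conditionRows.map (Nat.ofDigits (2 ^ 1024))) = true := by
  decide +kernel

theorem linearForm_map_map {κ α : Type*} [Field κ] (E : List α) (a : α → ℕ) (w : α → κ) :
    linearForm (E.map a) (E.map w) = (E.map fun d => (a d : κ) * w d).sum := by
  simp [linearForm, List.zipWith_map, List.zipWith_self]

theorem cast_conditionEntry {R : Type*} [CommSemiring R] (m u : ℕ) (l d : ℕ × ℕ × ℕ) :
    ((conditionEntry m u l d : ℕ) : R) = conditionEntry (m : R) (u : R) l d := by
  simp [conditionEntry]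

theorem map_conditionEntry {R S : Type*} [CommSemiring R] [CommSemiring S] (φ : R →+* S)
    (m u : R) (l d : ℕ × ℕ × ℕ) :
    φ (conditionEntry m u l d) = conditionEntry (φ m) (φ u) l d := by
  simp [conditionEntry, map_ofNat]

theorem nodup_monomialExponents : monomialExponents.Nodup := by
  decide +kernel

theorem eq_zero_of_conditionEntry {κ : Type*} [Field κ] [CharP κ 911] (w : ℕ × ℕ × ℕ → κ)
    (hw : ∀ n ∈ rootsMod, ∀ l ∈ derivativeOrders,
      ∑ d ∈ monomialExponents.toFinset, conditionEntry (-1) (n : κ) l d * w d = 0) :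
    ∀ d ∈ monomialExponents, w d = 0 := by
  have h := eq_zero_of_hasTrivialKernel (κ := κ) 911 (by norm_num) (2 ^ 1024) 90 911
    (by decide +kernel) conditionRows (monomialExponents.map w) (by simp; decide +kernel)
    (by
      intro r hr
      obtain ⟨e, -, rfl⟩ := List.mem_map.1 hr
      simp
      decide +kernel)
    (by
      intro r hr a ha
      obtain ⟨e, -, rfl⟩ := List.mem_map.1 hr
      obtain ⟨d, -, rfl⟩ := List.mem_map.1 ha
      exact Nat.mod_lt _ (by norm_num))
    hasTrivialKernel_conditionRows
    (by
      intro r hr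
      obtain ⟨⟨n, l⟩, he, rfl⟩ := List.mem_map.1 hr
      obtain ⟨hn, hl⟩ := List.pair_mem_product.1 he
      rw [linearForm_map_map, ← hw n hn l hl, List.sum_toFinset _ nodup_monomialExponents]
      have hm : ((910 : ℕ) : κ) = -1 := by
        have := CharP.cast_eq_zero κ 911
        push_cast at this ⊢
        linear_combination this
      refine congrArg List.sum (List.map_congr_left fun d _ => ?_)
      rw [← CharP.cast_eq_mod κ 911, cast_conditionEntry, hm])
  exact fun d hd => h _ (List.mem_map_of_mem hd)

/-- The restriction of `h₂` to the curve `h₁ = 0` in a rational parameter. -/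
noncomputable def baseLocusPolynomial : Polynomial ℤ :=
  .X ^ 9 + 4 * .X ^ 8 + 2 * .X ^ 7 - 10 * .X ^ 6 - 41 * .X ^ 5 - 66 * .X ^ 4 - 48 * .X ^ 3 -
    16 * .X ^ 2 - 2 * .X

theorem baseLocusPolynomial_monic : baseLocusPolynomial.Monic := by
  unfold baseLocusPolynomial
  monicity!

theorem dvd_eval_baseLocusPolynomial :
    ∀ n ∈ rootsMod, ((911 : ℕ) : ℤ) ∣ baseLocusPolynomial.eval (n : ℤ) := by
  intro n hn
  simp only [baseLocusPolynomial, Polynomial.eval_add, Polynomial.eval_sub, Polynomial.eval_mul,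
    Polynomial.eval_pow, Polynomial.eval_X, Polynomial.eval_ofNat]
  revert n
  decide +kernel

theorem eq_zero_of_conditionEntry_roots (v : ℕ × ℕ × ℕ → ℂ)
    (hv : ∀ u : ℂ, Polynomial.aeval u baseLocusPolynomial = 0 → ∀ l ∈ derivativeOrders,
      ∑ d ∈ monomialExponents.toFinset, conditionEntry (-1) u l d * v d = 0) :
    ∀ d ∈ monomialExponents, v d = 0 := by
  have : Fact (Nat.Prime 911) := ⟨by norm_num⟩
  obtain ⟨κ, _, _, φ, hφ⟩ := exists_reduction_algebraicInteger 911
  choose! u hu huφ using fun n (hn : n ∈ rootsMod) =>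
    hφ _ baseLocusPolynomial_monic n (dvd_eval_baseLocusPolynomial n hn)
  let M : Matrix (rootsMod ×ˢ derivativeOrders).toFinset monomialExponents.toFinset
    (integralClosure ℤ ℂ) := fun r d => conditionEntry (-1) (u r.1.1) r.1.2 d
  have hzero := eq_zero_of_reduction_mulVec (m := (rootsMod ×ˢ derivativeOrders).toFinset)
    (n := monomialExponents.toFinset)
    (by rw [Fintype.card_coe, Fintype.card_coe]; decide +kernel)
    (algebraMap (integralClosure ℤ ℂ) ℂ) Subtype.val_injective φ M ?_ (fun d => v d) ?_
  · exact fun d hd => congrFun hzero ⟨d, List.mem_toFinset.2 hd⟩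
  · intro w hw
    let w' : ℕ × ℕ × ℕ → κ := fun d => if h : d ∈ monomialExponents.toFinset then w ⟨d, h⟩ else 0
    have hw'_apply (d : monomialExponents.toFinset) : w' d = w d := dif_pos d.2
    have hw' : ∀ d ∈ monomialExponents, w' d = 0 := by
      refine eq_zero_of_conditionEntry w' fun n hn l hl => ?_
      rw [← Finset.sum_coe_sort]
      refine Eq.trans ?_ (congrFun hw ⟨(n, l), List.mem_toFinset.2
        (List.pair_mem_product.2 ⟨hn, hl⟩)⟩)
      simp only [Matrix.mulVec, dotProduct]
      refine Finset.sum_congr rfl fun d _ => ?_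
      change _ = φ (conditionEntry (-1) (u n) l d) * w d
      rw [map_conditionEntry, map_neg, map_one, huφ n hn, hw'_apply]
    funext d
    exact (hw'_apply d).symm.trans (hw' d (List.mem_toFinset.1 d.2))
  · funext r
    obtain ⟨hn, hl⟩ := List.pair_mem_product.1 (List.mem_toFinset.1 r.2)
    refine Eq.trans ?_ (hv _ (hu _ hn) _ hl)
    rw [← Finset.sum_coe_sort]
    simp only [Matrix.mulVec, dotProduct]
    refine Finset.sum_congr rfl fun d _ => ?_
    change algebraMap (integralClosure ℤ ℂ) ℂ (conditionEntry (-1) (u r.1.1) r.1.2 d) * v d = _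
    rw [map_conditionEntry, map_neg, map_one]
    rfl

theorem bind₁_rowForm_injective (A B : Matrix (Fin 3) (Fin 3) ℂ) (hAB : A * B = 1) :
    Function.Injective (bind₁ (rowForm A)) := by
  refine Function.LeftInverse.injective (g := bind₁ (rowForm B)) fun f => ?_
  have h (i : Fin 3) : bind₁ (rowForm B) (rowForm A i) = X i := by
    have hentry (k : Fin 3) : ∑ j, A i j * B j k = if i = k then 1 else 0 := by
      rw [← Matrix.mul_apply, hAB, Matrix.one_apply]
    simp only [rowForm, map_sum, map_mul, bind₁_X_right, Finset.mul_sum]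
    rw [Finset.sum_comm]
    simp_rw [algHom_C, algebraMap_eq, ← mul_assoc, ← Finset.sum_mul, ← C_mul, ← map_sum, hentry]
    simp
  rw [bind₁_bind₁]
  simp [h]

/-- The exponent vector of a monomial. -/
noncomputable def exponentVector (d : ℕ × ℕ × ℕ) : Fin 3 →₀ ℕ :=
  Finsupp.equivFunOnFinite.symm ![d.1, d.2.1, d.2.2]

theorem exponentVector_injective : Function.Injective exponentVector := by
  intro d e h
  have h' := Finsupp.equivFunOnFinite.symm.injective h
  have h0 := congrFun h' 0
  have h1 := congrFun h' 1
  have h2 := congrFun h' 2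
  simp at h0 h1 h2
  exact Prod.ext h0 (Prod.ext h1 h2)

theorem exists_exponentVector_eq (d : Fin 3 →₀ ℕ) (hd : d 0 + d 1 + d 2 = 16)
    (h0 : d 0 ≤ 10) (h1 : d 1 ≤ 10) (h2 : d 2 ≤ 10) :
    ∃ e ∈ monomialExponents, exponentVector e = d := by
  refine ⟨(d 0, d 1, d 2), ?_, ?_⟩
  · refine List.mem_map.2 ⟨(d 0, d 1), List.mem_filter.2 ⟨List.pair_mem_product.2
      ⟨List.mem_range.2 (by omega), List.mem_range.2 (by omega)⟩, ?_⟩, ?_⟩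
    · simp; omega
    · simp; omega
  · ext i
    fin_cases i <;> simp [exponentVector]

/-- The columns are the three points of multiplicity six. -/
noncomputable def coordinateChange : Matrix (Fin 3) (Fin 3) ℂ :=
  !![4, 0, 0; 9, 1, 0; 6, 1, 1]

/-- A base point of the pencil in the coordinates given by `coordinateChange`. -/
noncomputable def basePoint (u : ℂ) : Fin 3 → ℂ :=
  let x := u * (2 * u + 1)
  let y := u ^ 3 + (u + 1) * (2 * u + 1)
  let z := u ^ 3
  ![x, 4 * y + 9 * -1 * x, 4 * z + 4 * -1 * y + 3 * x]

theorem coordinateChange_mulVec_basePoint (u : ℂ) :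
    coordinateChange.mulVec (basePoint u) =
      ![4 * (u * (2 * u + 1)), 4 * (u ^ 3 + (u + 1) * (2 * u + 1)), 4 * u ^ 3] := by
  ext i
  fin_cases i <;>
    simp [coordinateChange, basePoint, Matrix.mulVec, dotProduct, Fin.sum_univ_three]
  all_goals ring

/-- Every homogeneous polynomial of degree 16 vanishing to order `≥ 4` at each of the nine base
points of the pencil `⟨h₁, h₂⟩` and to order `≥ 6` at `(4,9,6)`, `(0,1,1)` and `(0,0,1)` is
zero (the computation `h⁰₁₂,₀ = 0`). -/
theorem degree_sixteen_vanishing_h0_12_0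
    (f : MvPolynomial (Fin 3) ℂ)
    (hf : f.IsHomogeneous 16)
    (hbase : ∀ p : Fin 3 → ℂ, p ≠ 0 → MvPolynomial.eval p h₁ = 0 →
      MvPolynomial.eval p h₂ = 0 → VanishesToOrder f p 4)
    (hE0 : VanishesToOrder f ![4, 9, 6] 6)
    (hB1 : VanishesToOrder f ![0, 1, 1] 6)
    (hB2 : VanishesToOrder f ![0, 0, 1] 6) :
    f = 0 := by
  refine (map_eq_zero_iff _ (bind₁_rowForm_injective coordinateChange
    !![1 / 4, 0, 0; -9 / 4, 1, 0; 3 / 4, -1, 1] ?_)).1 ?_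
  · ext i j
    fin_cases i <;> fin_cases j <;>
      simp [coordinateChange, Matrix.mul_apply, Fin.sum_univ_three] <;> norm_num
  set F := bind₁ (rowForm coordinateChange) f with hF
  have hFhom : F.IsHomogeneous 16 := by
    refine hf.aeval (n := 1) _ fun i => ?_
    exact IsHomogeneous.sum _ _ _ fun j _ => (isHomogeneous_X ℂ j).C_mul _
  have hcorner (i : Fin 3) : VanishesToOrder F (Pi.single i 1) 6 := by
    refine VanishesToOrder.bind₁_rowForm _ _ ?_
    rw [Matrix.mulVec_single_one]
    fin_cases i
    · convert hE0 using 1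
      ext k; fin_cases k <;> rfl
    · convert hB1 using 1
      ext k; fin_cases k <;> rfl
    · convert hB2 using 1
      ext k; fin_cases k <;> rfl
  have hsupp : ∀ d, coeff d F ≠ 0 → ∃ e ∈ monomialExponents, exponentVector e = d := by
    intro d hd
    have hle (i : Fin 3) : d i ≤ 10 := by
      by_contra! hlt
      exact hd ((hcorner i).coeff_eq_zero_of_isHomogeneous hFhom i d (by omega))
    have hdeg := hFhom hd
    rw [Finsupp.weight_apply, Finsupp.sum_fintype _ _ (by simp), Fin.sum_univ_three] at hdeg
    exact exists_exponentVector_eq d (by simpa using hdeg) (hle 0) (hle 1) (hle 2)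
  have hbaseF (u : ℂ) (hu : Polynomial.aeval u baseLocusPolynomial = 0) :
      VanishesToOrder F (basePoint u) 4 := by
    have hu' : u ^ 9 + 4 * u ^ 8 + 2 * u ^ 7 - 10 * u ^ 6 - 41 * u ^ 5 - 66 * u ^ 4 -
        48 * u ^ 3 - 16 * u ^ 2 - 2 * u = 0 := by
      simpa [baseLocusPolynomial, map_ofNat] using hu
    refine VanishesToOrder.bind₁_rowForm _ _ ?_
    rw [coordinateChange_mulVec_basePoint]
    refine hbase _ ?_ ?_ ?_
    · intro h
      have h1 := congrFun h 1
      have h2 := congrFun h 2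
      simp at h1 h2
      simp [h2] at h1
    · simp [h₁]
      ring
    · simp [h₂]
      linear_combination 64 * hu'
  have hcoeff := eq_zero_of_conditionEntry_roots (fun d => coeff (exponentVector d) F) (by
    intro u hu l hl
    have hl3 : l.1 + l.2.1 + l.2.2 < 4 := by
      revert l
      decide
    have h := (hbaseF u hu).sum_coeff_eq_zero ![l.1, l.2.1, l.2.2] hl3
    rw [Finset.sum_subset (s₂ := monomialExponents.toFinset.image exponentVector),
      Finset.sum_image exponentVector_injective.injOn] at h
    · rw [← h]
      refine Finset.sum_congr rfl fun d _ => ?_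
      simp [conditionEntry, basePoint, exponentVector, Fin.prod_univ_three, mul_comm]
    · intro d hd
      obtain ⟨e, he, rfl⟩ := hsupp d (mem_support_iff.1 hd)
      exact Finset.mem_image_of_mem _ (List.mem_toFinset.2 he)
    · intro d _ hd
      rw [notMem_support_iff.1 hd, zero_mul])
  ext d
  by_contra hd
  obtain ⟨e, he, rfl⟩ := hsupp d hd
  exact hd (hcoeff e he)
end

section
/- Let h₁ = (y−z)²z − x³ − x²z and h₂ = x³ − 2xy² + 2xyz + y²z in ℂ[x,y,z]. The set of common zeros of h₁ and h₂ in ℂ³ ∖ {0}, considered up to nonzero scalar multiplication (equivalently, the common vanishing locus of h₁ and h₂ in the complex projective plane), consists of exactly nine points, and the class of (0,1,0) is one of them. -/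
open MvPolynomial

/-- This sextic, whose roots are the abscissae of the base points off the line `x = z` in the
chart `z = 1`, has six distinct roots. -/
theorem exists_finset_roots_sextic :
    ∃ R : Finset ℂ, R.card = 6 ∧
      ∀ x, x ∈ R ↔ 4 * x ^ 6 + 8 * x ^ 5 + 8 * x ^ 4 + 4 * x ^ 3 + x ^ 2 + 2 * x + 1 = 0 := by
  classical
  let f : Polynomial ℂ := 4 * .X ^ 6 + 8 * .X ^ 5 + 8 * .X ^ 4 + 4 * .X ^ 3 + .X ^ 2 + 2 * .X + 1
  have hdeg : f.natDegree = 6 := by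
    unfold f
    compute_degree!
  have hf : f ≠ 0 := by
    intro h
    simp [h] at hdeg
  have hsep : f.Separable := by
    rw [Polynomial.separable_def,
      Polynomial.isCoprime_iff_aeval_ne_zero_of_isAlgClosed (k := ℂ) (K := ℂ)]
    intro x
    by_contra! h
    obtain ⟨h0, h1⟩ := h
    simp [f] at h0 h1
    have : (1 : ℂ) = 0 := by
      linear_combination
        (-1494 - 3212 * x - 28640 * x ^ 2 - 43136 * x ^ 3 - 39864 * x ^ 4) / 3752 * h0 +
        (2623 + 477 * x + 2064 * x ^ 2 + 7908 * x ^ 3 + 9404 * x ^ 4 + 6644 * x ^ 5) / 3752 * h1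
    exact one_ne_zero this
  refine ⟨f.roots.toFinset, ?_, fun x => ?_⟩
  · rw [Multiset.toFinset_card_of_nodup (Polynomial.nodup_roots hsep),
      ← (IsAlgClosed.splits f).natDegree_eq_card_roots, hdeg]
  · simp [hf, f]

/-- In the affine chart `z = 1` the two cubics have exactly eight common zeros. -/
theorem exists_finset_affine_base_points :
    ∃ A : Finset (ℂ × ℂ), A.card = 8 ∧ ∀ x y, (x, y) ∈ A ↔
      (y - 1) ^ 2 - x ^ 3 - x ^ 2 = 0 ∧ x ^ 3 - 2 * x * y ^ 2 + 2 * x * y + y ^ 2 = 0 := by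
  classical
  obtain ⟨R, hR, hmem⟩ := exists_finset_roots_sextic
  obtain ⟨s, hs⟩ := IsAlgClosed.exists_pow_nat_eq (2 : ℂ) two_pos
  have hs0 : s ≠ 0 := by
    rintro rfl
    norm_num at hs
  let φ : ℂ → ℂ × ℂ := fun x => (x, -(2 * x ^ 3 + 2 * x ^ 2 + x - 1) / 2)
  have hφ : Function.Injective φ := fun a b h => congrArg Prod.fst h
  have hsne : 1 + s ≠ 1 - s := fun h => hs0 (by linear_combination h / 2)
  refine ⟨{(1, 1 + s), (1, 1 - s)} ∪ R.image φ, ?_, fun x y => ?_⟩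
  · rw [Finset.card_union_of_disjoint, Finset.card_image_of_injective _ hφ, hR,
      Finset.card_pair (by simpa using hsne)]
    rw [Finset.disjoint_left]
    intro a ha hb
    obtain ⟨x, hx, rfl⟩ := Finset.mem_image.1 hb
    have hx1 : x = 1 := by
      simp only [φ, Finset.mem_insert, Finset.mem_singleton, Prod.mk.injEq] at ha
      tauto
    rw [hmem, hx1] at hx
    norm_num at hx
  · have hiff : (x, y) ∈ ({(1, 1 + s), (1, 1 - s)} ∪ R.image φ : Finset (ℂ × ℂ)) ↔
        ((x = 1 ∧ y = 1 + s) ∨ (x = 1 ∧ y = 1 - s)) ∨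
          4 * x ^ 6 + 8 * x ^ 5 + 8 * x ^ 4 + 4 * x ^ 3 + x ^ 2 + 2 * x + 1 = 0 ∧
            -(2 * x ^ 3 + 2 * x ^ 2 + x - 1) / 2 = y := by
      simp [φ, ← hmem, or_assoc]
    rw [hiff]
    constructor
    · rintro ((⟨rfl, rfl⟩ | ⟨rfl, rfl⟩) | ⟨hx, rfl⟩)
      · exact ⟨by linear_combination hs, by linear_combination -hs⟩
      · exact ⟨by linear_combination hs, by linear_combination -hs⟩
      · constructor
        · linear_combination hx / 4
        · linear_combination (1 - 2 * x) * hx / 4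
    · rintro ⟨h1, h2⟩
      have h : (1 - x) * (2 * y + (2 * x ^ 3 + 2 * x ^ 2 + x - 1)) = 0 := by
        linear_combination h2 - (1 - 2 * x) * h1
      rcases mul_eq_zero.1 h with h | h
      · obtain rfl : x = 1 := by linear_combination -h
        have : (y - (1 + s)) * (y - (1 - s)) = 0 := by linear_combination h1 - hs
        rcases mul_eq_zero.1 this with h | h
        · exact .inl (.inl ⟨rfl, sub_eq_zero.1 h⟩)
        · exact .inl (.inr ⟨rfl, sub_eq_zero.1 h⟩)
      · obtain rfl : y = -(2 * x ^ 3 + 2 * x ^ 2 + x - 1) / 2 := by linear_combination h / 2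
        exact .inr ⟨by linear_combination 4 * h1, rfl⟩

theorem eval_h₁ (w : Fin 3 → ℂ) :
    MvPolynomial.eval w h₁ = (w 1 - w 2) ^ 2 * w 2 - w 0 ^ 3 - w 0 ^ 2 * w 2 := by
  simp [h₁]

theorem eval_h₂ (w : Fin 3 → ℂ) :
    MvPolynomial.eval w h₂ =
      w 0 ^ 3 - 2 * w 0 * w 1 ^ 2 + 2 * w 0 * w 1 * w 2 + w 1 ^ 2 * w 2 := by
  simp [h₂]

/-- The common vanishing locus of `h₁` and `h₂` in `ℂ³ ∖ {0}`, up to nonzero scalar (i.e. in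
the projective plane), consists of exactly nine points, one of which is the class of
`(0,1,0)`. -/
theorem pencil_has_nine_base_points :
    ∃ p : Fin 9 → (Fin 3 → ℂ),
      (∀ i, p i ≠ 0) ∧
      (∀ i, MvPolynomial.eval (p i) h₁ = 0 ∧ MvPolynomial.eval (p i) h₂ = 0) ∧
      (∀ i j, i ≠ j → ∀ c : ℂ, p i ≠ c • p j) ∧
      (∀ w : Fin 3 → ℂ, w ≠ 0 → MvPolynomial.eval w h₁ = 0 →
        MvPolynomial.eval w h₂ = 0 → ∃ i, ∃ c : ℂ, c ≠ 0 ∧ w = c • p i) ∧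
      (∃ i, ∃ c : ℂ, c ≠ 0 ∧ (![0, 1, 0] : Fin 3 → ℂ) = c • p i) := by
  obtain ⟨A, hA, hmem⟩ := exists_finset_affine_base_points
  let a : Fin 8 → ℂ × ℂ := fun i => A.equivFinOfCardEq hA |>.symm i
  have ha : Function.Injective a := Subtype.val_injective.comp (Equiv.injective _)
  have haA (i) : a i ∈ A := Subtype.property _
  have hAa {x y} (h : (x, y) ∈ A) : ∃ i, a i = (x, y) :=
    ⟨A.equivFinOfCardEq hA ⟨_, h⟩, by simp [a]⟩
  refine ⟨Fin.cons ![0, 1, 0] fun i => ![(a i).1, (a i).2, 1], ?_, ?_, ?_, ?_, 0, 1, by simp⟩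
  · refine Fin.cases ?_ fun i => ?_
    · exact fun h => by simpa using congrFun h 1
    · exact fun h => by simpa using congrFun h 2
  · refine Fin.cases ?_ fun i => ?_
    · simp [eval_h₁, eval_h₂]
    · simpa [eval_h₁, eval_h₂] using (hmem _ _).1 (haA i)
  · refine Fin.cases (Fin.cases ?_ fun j => ?_) fun i => Fin.cases ?_ fun j => ?_
    · exact fun h => absurd rfl h
    · intro _ c h
      have hc : c = 0 := by simpa using (congrFun h 2).symm
      simpa [hc] using congrFun h 1
    · intro _ c h
      simpa using congrFun h 2
    · intro hij c h
      have hc : c = 1 := by simpa using (congrFun h 2).symm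
      refine hij (congrArg Fin.succ (ha (Prod.ext ?_ ?_)))
      · simpa [hc] using congrFun h 0
      · simpa [hc] using congrFun h 1
  · intro w hw hw₁ hw₂
    rw [eval_h₁] at hw₁
    rw [eval_h₂] at hw₂
    by_cases hz : w 2 = 0
    · have hx : w 0 = 0 := by simpa [hz] using hw₁
      have hy : w 1 ≠ 0 := fun hy => hw (by ext i; fin_cases i <;> simp [hx, hy, hz])
      refine ⟨0, w 1, hy, ?_⟩
      ext i
      fin_cases i <;> simp [hx, hz]
    · obtain ⟨x, hx⟩ : ∃ x, w 0 = w 2 * x := ⟨w 0 / w 2, by field_simp⟩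
      obtain ⟨y, hy⟩ : ∃ y, w 1 = w 2 * y := ⟨w 1 / w 2, by field_simp⟩
      have hz3 : w 2 ^ 3 ≠ 0 := pow_ne_zero _ hz
      rw [hx, hy] at hw₁ hw₂
      obtain ⟨i, hi⟩ := hAa ((hmem x y).2
        ⟨mul_left_cancel₀ hz3 (by linear_combination hw₁),
          mul_left_cancel₀ hz3 (by linear_combination hw₂)⟩)
      refine ⟨i.succ, w 2, hz, ?_⟩
      ext k
      fin_cases k <;> simp [hi, hx, hy]
end
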